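/- Let n ≥ 1 be an integer, let a be an integer with 0 ≤ a ≤ n−1, let v be an integer with 0 ≤ v ≤ 2n−2a−3, let j be an integer with 0 ≤ j ≤ 2n−1, and let X be a real number such that (X + 2a + v − i + 3)_i ≠ 0 for every integer i with 0 ≤ i ≤ 2a+2. Then Σ_{i=0}^{2a+2} (−1)^i · binom(2a+2, i) · ( (X + 2n + v − i + 2)_i / (X + 2a + v − i + 3)_i ) · (2a + v − i − j + 2) · (X + 2a + v − i + 3)_j · (X + v − i + j + 3)_{2n−j−1} = 0. -/

import Mathlib

theorem eval_ascPochhammer_add (m k : ℕ) (s : ℝ) :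
    (ascPochhammer ℝ (m + k)).eval s =
      (ascPochhammer ℝ m).eval s * (ascPochhammer ℝ k).eval (s + m) := by
  simp [← ascPochhammer_mul]

open Polynomial in
/-- The alternating binomial sum of a polynomial of small degree along `y, y - 1, …` vanishes. -/
theorem sum_neg_one_pow_mul_choose_mul_eval_sub_eq_zero {P : ℝ[X]} {N : ℕ}
    (hP : P.natDegree < N) (y : ℝ) :
    ∑ i ∈ Finset.range (N + 1), (-1 : ℝ) ^ i * (N.choose i : ℝ) * P.eval (y - i) = 0 := by
  have hdeg : (P.comp (C y - X)).natDegree < N := by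
    have hlin : (C y - X : ℝ[X]).natDegree ≤ 1 := by compute_degree
    calc (P.comp (C y - X)).natDegree ≤ P.natDegree * (C y - X : ℝ[X]).natDegree :=
          natDegree_comp_le
      _ ≤ P.natDegree * 1 := Nat.mul_le_mul_left _ hlin
      _ < N := by rwa [mul_one]
  have hdiff := congrFun (fwdDiff_iter_eq_zero_of_degree_lt hdeg) 0
  rw [fwdDiff_iter_eq_sum_shift] at hdiff
  have hsum := congrArg ((-1 : ℝ) ^ N * ·) hdiff
  simp only [Finset.mul_sum, Pi.zero_apply, mul_zero] at hsum
  rw [← hsum]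
  refine Finset.sum_congr rfl fun i hi ↦ ?_
  have hi' : i ≤ N := Nat.lt_succ_iff.mp (Finset.mem_range.mp hi)
  have hsign : (-1 : ℝ) ^ N * (-1) ^ (N - i) = (-1) ^ i := by
    obtain ⟨k, rfl⟩ := Nat.exists_eq_add_of_le hi'
    rw [Nat.add_sub_cancel_left, pow_add, mul_assoc, ← mul_pow]
    simp
  simp [← hsign, mul_assoc]

/-- Two ways of covering the overlapping ranges `[s, s + j)` and `[s + j - b, s + m)`. -/
theorem ascPochhammer_eval_mul_eval_overlap {m j b k : ℕ} (h : m + b = j + k) (s : ℝ) :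
    (ascPochhammer ℝ j).eval s * (ascPochhammer ℝ k).eval (s + j - b) =
      (ascPochhammer ℝ m).eval s * (ascPochhammer ℝ b).eval (s + j - b) := by
  rcases le_total j m with hjm | hmj
  · obtain ⟨d, rfl⟩ := Nat.exists_eq_add_of_le hjm
    obtain rfl : k = b + d := by omega
    rw [eval_ascPochhammer_add b d, eval_ascPochhammer_add j d, sub_add_cancel]
    ring
  · obtain ⟨d, rfl⟩ := Nat.exists_eq_add_of_le hmj
    obtain rfl : b = k + d := by omega
    rw [eval_ascPochhammer_add k d, eval_ascPochhammer_add m d,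
      show s + ((m + d : ℕ) : ℝ) - ((k + d : ℕ) : ℝ) + k = s + m by push_cast; ring]
    ring


/-- Step 3 in the proof of Theorem 6 of Krattenthaler: the linear dependence of the rows
of `T_n(X, X-2a)`; here `(α)_m` is the Pochhammer symbol (rising factorial). -/
theorem stmt_13 (n : ℕ) (hn : 1 ≤ n) (a : ℕ) (ha : a ≤ n - 1)
    (v : ℕ) (hv : (v : ℤ) ≤ 2 * n - 2 * a - 3)
    (j : ℕ) (hj : j ≤ 2 * n - 1) (X : ℝ)
    (hX : ∀ i : ℕ, i ≤ 2 * a + 2 →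
      (ascPochhammer ℝ i).eval (X + 2 * a + v - i + 3) ≠ 0) :
    ∑ i ∈ Finset.range (2 * a + 3),
      (-1 : ℝ) ^ i * ((2 * a + 2).choose i : ℝ) *
        ((ascPochhammer ℝ i).eval (X + 2 * n + v - i + 2) /
          (ascPochhammer ℝ i).eval (X + 2 * a + v - i + 3)) *
        (2 * (a : ℝ) + v - i - j + 2) *
        (ascPochhammer ℝ j).eval (X + 2 * a + v - i + 3) *
        (ascPochhammer ℝ (2 * n - j - 1)).eval (X + v - i + j + 3) = 0 := by
  set y : ℝ := X + 2 * a + v + 3 with hy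
  set P : Polynomial ℝ := (Polynomial.X - Polynomial.C (X + 1 + j)) *
    (ascPochhammer ℝ (2 * a)).comp (Polynomial.X + Polynomial.C ((j : ℝ) - 2 * a)) with hP
  have hdeg : P.natDegree < 2 * a + 2 := by
    refine (Polynomial.natDegree_mul_le).trans_lt ?_
    rw [Polynomial.natDegree_X_sub_C, Polynomial.natDegree_comp, Polynomial.natDegree_X_add_C,
      ascPochhammer_natDegree]
    omega
  have hsum := sum_neg_one_pow_mul_choose_mul_eval_sub_eq_zero hdeg y
  rw [← mul_zero ((ascPochhammer ℝ (2 * n - 2 * a - 1)).eval y), ← hsum, Finset.mul_sum]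
  refine Finset.sum_congr rfl fun i hi ↦ ?_
  have hne := hX i (Nat.lt_succ_iff.mp (Finset.mem_range.mp hi))
  obtain ⟨c, rfl⟩ : ∃ c, n = a + c + 1 := ⟨n - a - 1, by omega⟩
  have hover := ascPochhammer_eval_mul_eval_overlap
    (m := i + (2 * c + 1)) (j := j) (b := 2 * a) (k := 2 * (a + c + 1) - j - 1 + i)
    (by omega) (y - i)
  rw [eval_ascPochhammer_add i, eval_ascPochhammer_add _ i] at hover
  have hlen : ((2 * (a + c + 1) - j - 1 : ℕ) : ℝ) = 2 * (a + c + 1) - j - 1 := by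
    rw [Nat.cast_sub (by omega), Nat.cast_sub (by omega)]
    push_cast
    ring
  have hs : X + 2 * a + v - i + 3 = y - i := by rw [hy]; ring
  rw [hs] at hne ⊢
  rw [show 2 * (a + c + 1) - 2 * a - 1 = 2 * c + 1 by omega,
    show X + 2 * ((a + c + 1 : ℕ) : ℝ) + v - i + 2 =
      y - i + j - (2 * a : ℕ) + (2 * (a + c + 1) - j - 1 : ℕ) by
        rw [hlen, hy]; push_cast; ring,
    show X + v - i + j + 3 = y - i + j - (2 * a : ℕ) by rw [hy]; push_cast; ring]
  have hPe : P.eval (y - i) = (2 * (a : ℝ) + v - i - j + 2) *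
      (ascPochhammer ℝ (2 * a)).eval (y - i + j - (2 * a : ℕ)) := by
    rw [hP, Polynomial.eval_mul, Polynomial.eval_comp]
    simp only [Polynomial.eval_sub, Polynomial.eval_add, Polynomial.eval_X, Polynomial.eval_C]
    congr 1
    · rw [hy]; ring
    · congr 1; push_cast; ring
  rw [sub_add_cancel] at hover
  rw [hPe]
  field_simp
  linear_combination ((2 * a + 2).choose i : ℝ) * (2 * (a : ℝ) + v - i - j + 2) * hover
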